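/- Let s₁, s₂ be Schur functions with |s₁(t)| = |s₂(t)| a.e. on an arc γ of the unit circle, and neither identically zero. If s₁ admits a pseudocontinuation of bounded type across γ, then so does s₂. -/

import Mathlib

open MeasureTheory Filter Complex Set Matrix

noncomputable section

/-- The open unit disk. -/
def unitDisk : Set ℂ := {z : ℂ | ‖z‖ < 1}

/-- The exterior of the closed unit disk. -/
def extDisk : Set ℂ := {z : ℂ | 1 < ‖z‖}

/-- Point on the unit circle with angle `θ`. -/
def circlePt (θ : ℝ) : ℂ := Complex.exp (θ * Complex.I)

/-- One full period of angles, parametrizing the circle 𝕋. -/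
def circleSet : Set ℝ := Set.Ioc 0 (2 * Real.pi)

/-- `RadLim f θ w` : the radial (nontangential) boundary value of `f` (analytic in the
disk) at the boundary point `circlePt θ` exists and equals `w`. -/
def RadLim (f : ℂ → ℂ) (θ : ℝ) (w : ℂ) : Prop :=
  Filter.Tendsto (fun r : ℝ => f ((r : ℂ) * circlePt θ))
    (nhdsWithin 1 (Set.Iio 1)) (nhds w)

/-- `RadLimExt f θ w` : the radial boundary value of `f` (analytic in the exterior disk)
at the boundary point `circlePt θ`, taken from outside. -/
def RadLimExt (f : ℂ → ℂ) (θ : ℝ) (w : ℂ) : Prop :=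
  Filter.Tendsto (fun r : ℝ => f ((r : ℂ) * circlePt θ))
    (nhdsWithin 1 (Set.Ioi 1)) (nhds w)

/-- A Schur function: analytic on the unit disk and bounded by 1 in modulus. -/
def SchurFn (f : ℂ → ℂ) : Prop :=
  DifferentiableOn ℂ f unitDisk ∧ ∀ z ∈ unitDisk, ‖f z‖ ≤ 1

/-- The Nevanlinna class on a domain `Ω` : quotients of two bounded (contractive)
analytic functions, with not-identically-zero denominator. -/
def NevOn (Ω : Set ℂ) (f : ℂ → ℂ) : Prop :=
  ∃ f₁ f₂ : ℂ → ℂ, DifferentiableOn ℂ f₁ Ω ∧ DifferentiableOn ℂ f₂ Ω ∧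
    (∀ z ∈ Ω, ‖f₁ z‖ ≤ 1) ∧ (∀ z ∈ Ω, ‖f₂ z‖ ≤ 1) ∧
    (∃ z ∈ Ω, f₂ z ≠ 0) ∧ (∀ z ∈ Ω, f₂ z ≠ 0 → f z = f₁ z / f₂ z)

/-- An arc of the unit circle, described by its set of angles (one full period is
`Set.Ioo 0 (2π)` up to a null set, so the case γ = 𝕋 is not excluded). -/
def IsArc (γ : Set ℝ) : Prop :=
  ∃ a b : ℝ, 0 ≤ a ∧ a < b ∧ b ≤ 2 * Real.pi ∧ γ = Set.Ioo a b

/-- `f` admits a pseudocontinuation of bounded type across the arc with angle set `γ` :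
there is a Nevanlinna function on the exterior disk whose boundary values agree with
those of `f` a.e. on `γ`. -/
def PCArc (f : ℂ → ℂ) (γ : Set ℝ) : Prop :=
  ∃ ft : ℂ → ℂ, NevOn extDisk ft ∧
    ∀ᵐ θ ∂(volume.restrict γ), ∃ w : ℂ, RadLim f θ w ∧ RadLimExt ft θ w

/-- The boundary values of `f` exist and are unimodular a.e. on `γ`. -/
def UnimodularAEOn (f : ℂ → ℂ) (γ : Set ℝ) : Prop :=
  ∀ᵐ θ ∂(volume.restrict γ), ∃ w : ℂ, RadLim f θ w ∧ ‖w‖ = 1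

/-- The boundary values of the 2×2 matrix function `S` exist and are unitary a.e. on `γ`. -/
def UnitaryAEOn (S : ℂ → Matrix (Fin 2) (Fin 2) ℂ) (γ : Set ℝ) : Prop :=
  ∀ᵐ θ ∂(volume.restrict γ), ∃ W : Matrix (Fin 2) (Fin 2) ℂ,
    (∀ i j, RadLim (fun z => S z i j) θ (W i j)) ∧ Wᴴ * W = 1

/-- An outer function on the unit disk (normalized, with multiplicative constant 1):
`f z = exp (∫_𝕋 (t+z)/(t-z) φ(t) dm(t))` for some real integrable boundary data `φ`,
`m` being normalized Lebesgue measure on 𝕋. -/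
def IsOuter (f : ℂ → ℂ) : Prop :=
  ∃ φ : ℝ → ℝ, IntegrableOn φ circleSet ∧
    ∀ z ∈ unitDisk, f z =
      Complex.exp (∫ θ in circleSet,
        ((circlePt θ + z) / (circlePt θ - z)) * (φ θ : ℂ) / (2 * Real.pi))

lemma isOpen_unitDisk : IsOpen unitDisk := isOpen_lt continuous_norm continuous_const

lemma isPreconnected_unitDisk : IsPreconnected unitDisk := by
  have : unitDisk = Metric.ball 0 1 := by ext; simp [unitDisk]
  rw [this]
  exact (convex_ball 0 1).isPreconnected

lemma isOpen_extDisk : IsOpen extDisk := isOpen_lt continuous_const continuous_norm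

lemma continuous_circlePt : Continuous circlePt := by
  unfold circlePt
  fun_prop

lemma norm_circlePt (θ : ℝ) : ‖circlePt θ‖ = 1 := Complex.norm_exp_ofReal_mul_I θ

lemma circleMap_zero_eq_mul_circlePt (r θ : ℝ) : circleMap 0 r θ = r * circlePt θ := by
  simp [circleMap, circlePt]

lemma isPreconnected_extDisk : IsPreconnected extDisk := by
  have : extDisk = (fun p : ℝ × ℝ => (p.1 : ℂ) * circlePt p.2) '' (Ioi 1 ×ˢ univ) := by
    ext z
    constructor
    · intro hz
      exact ⟨(‖z‖, z.arg), ⟨hz, mem_univ _⟩, Complex.norm_mul_exp_arg_mul_I z⟩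
    · rintro ⟨⟨r, θ⟩, ⟨hr, -⟩, rfl⟩
      have hr : 1 < r := hr
      simpa [extDisk, norm_circlePt] using hr.trans_le (le_abs_self r)
  rw [this]
  refine (isPreconnected_Ioi.prod isPreconnected_univ).image _ (Continuous.continuousOn ?_)
  have := continuous_circlePt
  fun_prop

/-- Jensen's formula bounds the circle averages of `log ‖f‖` from below, uniformly as the radius
tends to `1`. -/
lemma exists_le_circleAverage_log_norm {f : ℂ → ℂ} (hf : DifferentiableOn ℂ f unitDisk) :
    ∃ C : ℝ, ∀ r : ℝ, 1 / 2 ≤ r → r < 1 →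
      C ≤ Real.circleAverage (fun z => Real.log ‖f z‖) 0 r := by
  have hfa : AnalyticOnNhd ℂ f unitDisk := hf.analyticOnNhd isOpen_unitDisk
  refine ⟨(meromorphicOrderAt f 0).untop₀ * Real.log (1 / 2)
    + Real.log ‖meromorphicTrailingCoeffAt f 0‖, fun r hr hr1 => ?_⟩
  have hr0 : 0 < r := by linarith
  have hsub : Metric.closedBall (0 : ℂ) |r| ⊆ unitDisk := by
    intro z hz
    have : ‖z‖ ≤ r := by simpa [abs_of_pos hr0] using hz
    exact this.trans_lt hr1
  have hfr := hfa.mono hsub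
  have h0 : (0 : ℂ) ∈ Metric.closedBall (0 : ℂ) |r| := by simp
  rw [MeromorphicOn.circleAverage_log_norm hr0.ne' hfr.meromorphicOn]
  have hdiv : 0 ≤ ∑ᶠ u, (MeromorphicOn.divisor f (Metric.closedBall (0 : ℂ) |r|) u : ℝ)
      * Real.log (r * ‖0 - u‖⁻¹) := by
    refine finsum_nonneg fun u => ?_
    by_cases hu : u ∈ Metric.closedBall (0 : ℂ) |r|
    · refine mul_nonneg (mod_cast MeromorphicOn.AnalyticOnNhd.divisor_nonneg hfr u) ?_
      rcases eq_or_ne u 0 with rfl | hu0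
      · simp
      · apply Real.log_nonneg
        have : ‖u‖ ≤ r := by simpa [abs_of_pos hr0] using hu
        rw [zero_sub, norm_neg, ← div_eq_mul_inv, one_le_div (norm_pos_iff.2 hu0)]
        exact this
    · simp [hu]
  have hord : (meromorphicOrderAt f 0).untop₀ * Real.log (1 / 2)
      ≤ MeromorphicOn.divisor f (Metric.closedBall (0 : ℂ) |r|) 0 * Real.log r := by
    have hn := MeromorphicOn.AnalyticOnNhd.divisor_nonneg hfr 0
    rw [MeromorphicOn.divisor_apply hfr.meromorphicOn h0] at hn ⊢
    exact mul_le_mul_of_nonneg_left (Real.log_le_log (by norm_num) hr) (mod_cast hn)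
  linarith

lemma countable_zeros {f : ℂ → ℂ} (hf : DifferentiableOn ℂ f unitDisk)
    (hne : ∃ z ∈ unitDisk, f z ≠ 0) : {z ∈ unitDisk | f z = 0}.Countable := by
  rcases (hf.analyticOnNhd isOpen_unitDisk).eqOn_zero_or_eventually_ne_zero_of_preconnected
    isPreconnected_unitDisk with h | h
  · obtain ⟨z, hz, hfz⟩ := hne
    exact absurd (h hz) hfz
  · have h' : {z | f z ≠ 0}ᶜ ∩ unitDisk = {z ∈ unitDisk | f z = 0} := by
      ext z
      simp [and_comm]
    rw [← h']
    exact (HereditarilyLindelofSpace.isLindelof _).countable_of_isDiscrete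
      (isDiscrete_of_codiscreteWithin (by simpa using! h))

/-- Almost every radius avoids the zeros of a nonzero analytic function on the disk. -/
lemma ae_forall_radius_ne_zero {f : ℂ → ℂ} (hf : DifferentiableOn ℂ f unitDisk)
    (hne : ∃ z ∈ unitDisk, f z ≠ 0) :
    ∀ᵐ θ : ℝ, ∀ r : ℝ, 0 < r → r < 1 → f (r * circlePt θ) ≠ 0 := by
  have hc := ((countable_zeros hf hne).image fun z => z / (‖z‖ : ℂ)).preimage_circleMap 0
    one_ne_zero
  filter_upwards [hc.ae_notMem volume] with θ hθ r hr hr1 hzero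
  apply hθ
  refine ⟨r * circlePt θ, ⟨?_, hzero⟩, ?_⟩
  · simpa [unitDisk, norm_circlePt, abs_of_pos hr] using hr1
  · have : (r : ℂ) ≠ 0 := mod_cast hr.ne'
    rw [circleMap_zero_eq_mul_circlePt]
    simp [norm_circlePt, abs_of_pos hr, this]

/-- **F. and M. Riesz**: a nonzero Schur function has a vanishing radial limit at almost no point
of the circle. -/
theorem SchurFn.ae_not_radLim_zero {f : ℂ → ℂ} (hf : SchurFn f) (hne : ∃ z ∈ unitDisk, f z ≠ 0) :
    ∀ᵐ θ ∂(volume.restrict circleSet), ¬ RadLim f θ 0 := by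
  obtain ⟨C, hC⟩ := exists_le_circleAverage_log_norm hf.1
  set r : ℕ → ℝ := fun n => 1 - 1 / ((n : ℝ) + 2) with hr
  have hr2 (n : ℕ) : 1 / 2 ≤ r n := by
    have : 1 / ((n : ℝ) + 2) ≤ 1 / 2 := by gcongr; linarith [Nat.cast_nonneg (α := ℝ) n]
    simp only [hr]; linarith
  have hr1 (n : ℕ) : r n < 1 := by
    have : 0 < 1 / ((n : ℝ) + 2) := by positivity
    simp only [hr]; linarith
  have hmem (n : ℕ) (θ : ℝ) : (r n : ℂ) * circlePt θ ∈ unitDisk := by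
    have := hr2 n
    simpa [unitDisk, norm_circlePt, abs_of_pos (by linarith : 0 < r n)] using hr1 n
  have hrlim : Tendsto r atTop (nhdsWithin 1 (Iio 1)) := by
    refine tendsto_nhdsWithin_iff.2 ⟨?_, .of_forall hr1⟩
    have : Tendsto (fun n : ℕ => (n : ℝ) + 2) atTop atTop :=
      tendsto_atTop_add_const_right _ _ tendsto_natCast_atTop_atTop
    simpa [hr] using (this.inv_tendsto_atTop).const_sub 1
  set g : ℕ → ℝ → ENNReal := fun n θ => ENNReal.ofReal (-Real.log ‖f (r n * circlePt θ)‖) with hg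
  have hgm (n : ℕ) : Measurable (g n) := by
    have hcont : Continuous fun θ : ℝ => f (r n * circlePt θ) :=
      hf.1.continuousOn.comp_continuous (continuous_const.mul continuous_circlePt) (hmem n)
    exact ((Real.measurable_log.comp hcont.norm.measurable).neg).ennreal_ofReal
  have hgint (n : ℕ) : ∫⁻ θ in circleSet, g n θ ≤ ENNReal.ofReal (2 * Real.pi * -C) := by
    have hmer : MeromorphicOn f (Metric.sphere 0 |r n|) := by
      refine ((hf.1.analyticOnNhd isOpen_unitDisk).mono fun z hz => ?_).meromorphicOn
      have h := hr2 n
      have : ‖z‖ = r n := by simpa [abs_of_pos (by linarith : 0 < r n)] using hz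
      exact this.trans_lt (hr1 n)
    have hint := hmer.circleIntegrable_log_norm
    rw [CircleIntegrable, intervalIntegrable_iff_integrableOn_Ioc_of_le
      Real.two_pi_pos.le] at hint
    simp only [circleMap_zero_eq_mul_circlePt] at hint
    have hav := hC (r n) (hr2 n) (hr1 n)
    rw [Real.circleAverage_def, intervalIntegral.integral_of_le Real.two_pi_pos.le] at hav
    simp only [circleMap_zero_eq_mul_circlePt, smul_eq_mul] at hav
    rw [inv_mul_eq_div, le_div_iff₀ Real.two_pi_pos] at hav
    refine (ofReal_integral_eq_lintegral_ofReal hint.neg (.of_forall fun θ => ?_)).ge.trans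
      (ENNReal.ofReal_le_ofReal ?_)
    · simpa using Real.log_nonpos (norm_nonneg _) (hf.2 _ (hmem n θ))
    · simp only [Pi.neg_apply]
      rw [integral_neg]
      linarith
  have hfatou : ∫⁻ θ in circleSet, liminf (fun n => g n θ) atTop
      ≤ ENNReal.ofReal (2 * Real.pi * -C) :=
    (lintegral_liminf_le hgm).trans <| liminf_le_of_le (by isBoundedDefault) fun b hb =>
      let ⟨n, hn⟩ := hb.exists
      hn.trans (hgint n)
  have hfin := ae_lt_top (Measurable.liminf hgm) (hfatou.trans_lt ENNReal.ofReal_lt_top).ne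
  filter_upwards [hfin, ae_restrict_of_ae (ae_forall_radius_ne_zero hf.1 hne)] with θ hθ hnz hlim
  refine hθ.ne (Tendsto.liminf_eq ?_)
  have h0 : Tendsto (fun n => ‖f (r n * circlePt θ)‖) atTop (nhdsWithin 0 (Ioi 0)) := by
    refine tendsto_nhdsWithin_iff.2 ⟨by simpa using (hlim.comp hrlim).norm, .of_forall fun n => ?_⟩
    exact norm_pos_iff.2 (hnz (r n) (by linarith [hr2 n]) (hr1 n))
  exact ENNReal.tendsto_ofReal_atTop.comp
    (tendsto_neg_atBot_atTop.comp (Real.tendsto_log_nhdsGT_zero.comp h0))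

/-- The reflection of a function across the unit circle. -/
def circleReflect (s : ℂ → ℂ) (z : ℂ) : ℂ :=
  (starRingEnd ℂ) (s ((starRingEnd ℂ) z⁻¹))

lemma conj_inv_mem_unitDisk {z : ℂ} (hz : z ∈ extDisk) : (starRingEnd ℂ) z⁻¹ ∈ unitDisk := by
  simpa [unitDisk] using inv_lt_one_of_one_lt₀ hz

lemma SchurFn.differentiableOn_circleReflect {s : ℂ → ℂ} (hs : SchurFn s) :
    DifferentiableOn ℂ (circleReflect s) extDisk := by
  intro z hz
  have hz0 : z ≠ 0 := norm_pos_iff.1 (one_pos.trans hz)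
  have h1 : DifferentiableAt ℂ s ((starRingEnd ℂ) z⁻¹) :=
    hs.1.differentiableAt (isOpen_unitDisk.mem_nhds (conj_inv_mem_unitDisk hz))
  have h2 := h1.conj_conj
  rw [Complex.conj_conj] at h2
  exact (h2.comp z (differentiableAt_inv hz0)).differentiableWithinAt

lemma SchurFn.norm_circleReflect_le {s : ℂ → ℂ} (hs : SchurFn s) {z : ℂ} (hz : z ∈ extDisk) :
    ‖circleReflect s z‖ ≤ 1 := by
  simpa [circleReflect] using hs.2 _ (conj_inv_mem_unitDisk hz)

lemma exists_circleReflect_ne_zero {s : ℂ → ℂ} (hs : SchurFn s) (hne : ∃ z ∈ unitDisk, s z ≠ 0) :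
    ∃ z ∈ extDisk, circleReflect s z ≠ 0 := by
  obtain ⟨z, ⟨hz, hz0⟩, hsz⟩ : ∃ z, (z ∈ unitDisk ∧ z ≠ 0) ∧ s z ≠ 0 := by
    by_contra! h
    obtain ⟨z, hz, hsz⟩ := hne
    refine hsz ((hs.1.analyticOnNhd isOpen_unitDisk).eqOn_zero_of_preconnected_of_frequently_eq_zero
      isPreconnected_unitDisk (z₀ := 0) (by simp [unitDisk]) (Eventually.frequently ?_) hz)
    filter_upwards [self_mem_nhdsWithin,
      mem_nhdsWithin_of_mem_nhds (isOpen_unitDisk.mem_nhds (by simp [unitDisk]))] with w hw hw'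
    exact h w ⟨hw', hw⟩
  refine ⟨(starRingEnd ℂ) z⁻¹, ?_, ?_⟩
  · simpa [extDisk] using (one_lt_inv₀ (norm_pos_iff.2 hz0)).2 hz
  · simpa [circleReflect] using hsz

lemma RadLim.circleReflect {s : ℂ → ℂ} {θ : ℝ} {w : ℂ} (h : RadLim s θ w) :
    RadLimExt (circleReflect s) θ ((starRingEnd ℂ) w) := by
  have hinv : Tendsto (fun r : ℝ => r⁻¹) (nhdsWithin 1 (Ioi 1)) (nhdsWithin 1 (Iio 1)) := by
    refine tendsto_nhdsWithin_iff.2 ⟨?_, ?_⟩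
    · simpa using (tendsto_inv₀ (one_ne_zero (α := ℝ))).mono_left nhdsWithin_le_nhds
    · filter_upwards [self_mem_nhdsWithin] with r hr using inv_lt_one_of_one_lt₀ (mem_Ioi.1 hr)
  refine ((Complex.continuous_conj.tendsto w).comp (h.comp hinv)).congr fun r => ?_
  have hc : (starRingEnd ℂ) (circlePt θ)⁻¹ = circlePt θ := by
    rw [Complex.inv_eq_conj (norm_circlePt θ), Complex.conj_conj]
  simp only [Function.comp_apply, _root_.circleReflect, mul_inv, map_mul, hc]
  simp

lemma IsArc.ae_restrict {γ : Set ℝ} (hγ : IsArc γ) {p : ℝ → Prop}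
    (h : ∀ᵐ θ ∂(volume.restrict circleSet), p θ) : ∀ᵐ θ ∂(volume.restrict γ), p θ := by
  obtain ⟨a, b, ha, -, hb, rfl⟩ := hγ
  exact ae_restrict_of_ae_restrict_of_subset
    (fun _ hθ => mem_Ioc.2 ⟨ha.trans_lt hθ.1, hθ.2.le.trans hb⟩) h

/-- Proposition 1: two not-identically-zero Schur functions with equal
boundary moduli a.e. on the arc `γ` admit pseudocontinuations of bounded type across
`γ` simultaneously. -/
theorem statement11 (s₁ s₂ : ℂ → ℂ) (γ : Set ℝ) (hγ : IsArc γ)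
    (h1 : SchurFn s₁) (h2 : SchurFn s₂)
    (hn1 : ∃ z ∈ unitDisk, s₁ z ≠ 0) (hn2 : ∃ z ∈ unitDisk, s₂ z ≠ 0)
    (heq : ∀ᵐ θ ∂(volume.restrict γ), ∃ w₁ w₂ : ℂ,
      RadLim s₁ θ w₁ ∧ RadLim s₂ θ w₂ ∧ ‖w₁‖ = ‖w₂‖)
    (hpc : PCArc s₁ γ) : PCArc s₂ γ := by
  obtain ⟨ft, ⟨f₁, f₂, hf₁, hf₂, hb₁, hb₂, hne, hquot⟩, hlim⟩ := hpc
  refine ⟨fun z => ft z * circleReflect s₁ z / circleReflect s₂ z,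
    ⟨fun z => f₁ z * circleReflect s₁ z, fun z => f₂ z * circleReflect s₂ z,
      hf₁.mul h1.differentiableOn_circleReflect, hf₂.mul h2.differentiableOn_circleReflect,
      fun z hz => ?_, fun z hz => ?_, ?_, fun z hz hz0 => ?_⟩, ?_⟩
  · rw [norm_mul]
    exact mul_le_one₀ (hb₁ z hz) (norm_nonneg _) (h1.norm_circleReflect_le hz)
  · rw [norm_mul]
    exact mul_le_one₀ (hb₂ z hz) (norm_nonneg _) (h2.norm_circleReflect_le hz)
  · by_contra! h
    obtain ⟨u, hu, hu0⟩ := hne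
    obtain ⟨v, hv, hv0⟩ := exists_circleReflect_ne_zero h2 hn2
    rcases AnalyticOnNhd.eq_zero_or_eq_zero_of_mul_eq_zero
      (hf₂.analyticOnNhd isOpen_extDisk)
      (h2.differentiableOn_circleReflect.analyticOnNhd isOpen_extDisk) h
      isPreconnected_extDisk with h' | h'
    · exact hu0 (h' u hu)
    · exact hv0 (h' v hv)
  · beta_reduce at hz0 ⊢
    rw [hquot z hz (left_ne_zero_of_mul hz0), div_mul_eq_mul_div, div_div]
  · filter_upwards [heq, hlim, hγ.ae_restrict (h2.ae_not_radLim_zero hn2)] with θ hw hv hnz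
    obtain ⟨w₁, w₂, hw₁, hw₂, hnorm⟩ := hw
    obtain ⟨v, hv₁, hv₂⟩ := hv
    obtain rfl : w₁ = v := tendsto_nhds_unique hw₁ hv₁
    have hw0 : w₂ ≠ 0 := by
      rintro rfl
      exact hnz hw₂
    have hc0 : (starRingEnd ℂ) w₂ ≠ 0 := (map_ne_zero _).2 hw0
    have hval : w₁ * (starRingEnd ℂ) w₁ / (starRingEnd ℂ) w₂ = w₂ := by
      rw [div_eq_iff hc0, Complex.mul_conj', Complex.mul_conj', hnorm]
    refine ⟨w₂, hw₂, ?_⟩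
    have := (hv₂.mul hw₁.circleReflect).div hw₂.circleReflect hc0
    rwa [hval] at this
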